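/- Let (W, N, Y) be a one-variable Deligne system on V. Then there exists a unique grading Y' of W with [Y, Y'] = 0 which has the Deligne grading property: there exists N₀⁺ ∈ End(V) with [Y', N₀⁺] = 0 such that (N₀⁺, Y − Y', N₀) is a standard triple and [N − N₀, N₀⁺] = 0, where N₀ denotes the component of N in the 0-eigenspace of ad Y' acting on End(V). -/

import Mathlib

/-- An increasing filtration of `V`: an increasing family of subspaces indexed by `ℤ`,
eventually `⊥` below and eventually `⊤` above. -/
def IsIncFilt {K V : Type} [Field K] [AddCommGroup V] [Module K V]
    (W : ℤ → Submodule K V) : Prop :=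
  Monotone W ∧ (∃ a : ℤ, ∀ k ≤ a, W k = ⊥) ∧ (∃ b : ℤ, ∀ k, b ≤ k → W k = ⊤)

/-- The `j`-eigenspace `E_j(Y) = ker (Y - j·1)` of an endomorphism, for an integer `j`. -/
def intEig {K V : Type} [Field K] [AddCommGroup V] [Module K V]
    (Y : Module.End K V) (j : ℤ) : Submodule K V :=
  LinearMap.ker (Y - (j : K) • (1 : Module.End K V))

/-- `Y` is a grading of the filtration `W`: `Y` is semisimple with integer eigenvalues
(`V` is the direct sum of the integer eigenspaces, whose mutual independence is automatic)
and `W k = ⊕_{j ≤ k} E_j(Y)` for all `k`. -/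
def IsGrading {K V : Type} [Field K] [AddCommGroup V] [Module K V]
    (Y : Module.End K V) (W : ℤ → Submodule K V) : Prop :=
  (⨆ j : ℤ, intEig Y j) = ⊤ ∧ ∀ k : ℤ, W k = ⨆ j ≤ k, intEig Y j

/-- The adjoint action `ad Y = [Y, ·]` on `End(V)`. -/
def adE {K V : Type} [Field K] [AddCommGroup V] [Module K V]
    (Y : Module.End K V) : Module.End K (Module.End K V) :=
  LinearMap.mulLeft K Y - LinearMap.mulRight K Y

/-- `M` is the relative weight filtration of `N` with respect to `W`:
`N(M_k) ⊆ M_{k-2}`, and for all `k ∈ ℤ` and `ℓ ≥ 0` the map induced by `N^ℓ` from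
`Gr^M_{k+ℓ} Gr^W_k` to `Gr^M_{k-ℓ} Gr^W_k` is an isomorphism (expressed here as surjectivity
and injectivity conditions on the corresponding submodules of `V`). -/
def IsRelWeightFilt {K V : Type} [Field K] [AddCommGroup V] [Module K V]
    (N : Module.End K V) (W M : ℤ → Submodule K V) : Prop :=
  (∀ k : ℤ, Submodule.map N (M k) ≤ M (k - 2)) ∧
  ∀ (k : ℤ) (ℓ : ℕ),
    (M (k - ℓ) ⊓ W k ≤
      Submodule.map (N ^ ℓ) (M (k + ℓ) ⊓ W k) ⊔ ((M (k - ℓ - 1) ⊓ W k) ⊔ W (k - 1))) ∧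
    ((M (k + ℓ) ⊓ W k) ⊓
        Submodule.comap (N ^ ℓ) ((M (k - ℓ - 1) ⊓ W k) ⊔ W (k - 1)) ≤
      (M (k + ℓ - 1) ⊓ W k) ⊔ W (k - 1))

/-- A one-variable Deligne system `(W, N, Y)`: `W` an increasing filtration, `N` a nilpotent
endomorphism preserving `W`, and `Y` a grading of an increasing filtration `M` of `V` such
that `Y` preserves `W`, `[Y, N] = -2N`, and `M` is the relative weight filtration of `N`
with respect to `W`. -/
def IsDeligneSystem1 {K V : Type} [Field K] [AddCommGroup V] [Module K V]
    (W : ℤ → Submodule K V) (N Y : Module.End K V) : Prop :=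
  IsIncFilt W ∧ IsNilpotent N ∧ (∀ k : ℤ, Submodule.map N (W k) ≤ W k) ∧
  ∃ M : ℤ → Submodule K V, IsIncFilt M ∧ IsGrading Y M ∧
    (∀ k : ℤ, Submodule.map Y (W k) ≤ W k) ∧ (Y * N - N * Y = -(2 • N)) ∧
    IsRelWeightFilt N W M

/-- `N₀` is the component of `N` in the `0`-eigenspace of `ad Y'`: `[Y', N₀] = 0` and
`N - N₀` lies in the sum of the nonzero integer eigenspaces of `ad Y'`. -/
def IsZeroComponent {K V : Type} [Field K] [AddCommGroup V] [Module K V]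
    (Y' N N₀ : Module.End K V) : Prop :=
  adE Y' N₀ = 0 ∧
  N - N₀ ∈ ⨆ j ∈ {j : ℤ | j ≠ 0},
    LinearMap.ker (adE Y' - (j : K) • (1 : Module.End K (Module.End K V)))

/-- `(N⁺, Y, N)` is a standard triple: `[Y, N⁺] = 2N⁺`, `[N⁺, N] = Y`, `[Y, N] = -2N`. -/
def IsStdTriple {K V : Type} [Field K] [AddCommGroup V] [Module K V]
    (Np Y N : Module.End K V) : Prop :=
  Y * Np - Np * Y = 2 • Np ∧ Np * N - N * Np = Y ∧ Y * N - N * Y = -(2 • N)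

/-- `Y'` has the Deligne grading property for `(N, Y)`: there exist `N₀⁺` commuting with `Y'`
such that `(N₀⁺, Y - Y', N₀)` is a standard triple and `[N - N₀, N₀⁺] = 0`, where `N₀` is the
component of `N` in the `0`-eigenspace of `ad Y'`. -/
def HasDGP {K V : Type} [Field K] [AddCommGroup V] [Module K V]
    (N Y Y' : Module.End K V) : Prop :=
  ∃ N₀ Np : Module.End K V, IsZeroComponent Y' N N₀ ∧ adE Y' Np = 0 ∧
    IsStdTriple Np (Y - Y') N₀ ∧ (N - N₀) * Np = Np * (N - N₀)

section Gradings

variable {K V : Type} [Field K] [AddCommGroup V] [Module K V]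

theorem mem_intEig {Y : Module.End K V} {j : ℤ} {v : V} :
    v ∈ intEig Y j ↔ Y v = (j : K) • v := by
  simp [intEig, sub_eq_zero]

theorem adE_apply (A X : Module.End K V) : adE A X = A * X - X * A := rfl

theorem adE_adE (A B X : Module.End K V) :
    adE A (adE B X) = adE B (adE A X) + adE (adE A B) X := by
  simp only [adE_apply]
  noncomm_ring

theorem adE_swap (A B : Module.End K V) : adE A B = -adE B A := by
  simp only [adE_apply, neg_sub]

theorem adE_smul_left (c : K) (A X : Module.End K V) : adE (c • A) X = c • adE A X := by
  simp only [adE_apply, smul_mul_assoc, mul_smul_comm, smul_sub]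

theorem adE_sub_left (A B X : Module.End K V) : adE (A - B) X = adE A X - adE B X := by
  simp only [adE_apply]
  noncomm_ring

theorem adE_eq_zero {A X : Module.End K V} : adE A X = 0 ↔ A * X = X * A := sub_eq_zero

/-- `D` acts on each graded piece `W k / W (k - 1)` as multiplication by `k`. -/
def ActsByWeight (D : Module.End K V) (W : ℤ → Submodule K V) : Prop :=
  ∀ k : ℤ, ∀ w ∈ W k, D w - (k : K) • w ∈ W (k - 1)

theorem IsGrading.intEig_le {D : Module.End K V} {W : ℤ → Submodule K V}
    (h : IsGrading D W) {j k : ℤ} (hjk : j ≤ k) : intEig D j ≤ W k := by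
  rw [h.2 k]
  exact le_iSup₂_of_le j hjk le_rfl

theorem IsGrading.actsByWeight {D : Module.End K V} {W : ℤ → Submodule K V}
    (h : IsGrading D W) : ActsByWeight D W := by
  intro k
  suffices W k ≤ (W (k - 1)).comap (D - (k : K) • (1 : Module.End K V)) from
    fun w hw => by simpa using this hw
  rw [h.2 k]
  refine iSup₂_le fun j hj v hv => ?_
  rw [mem_intEig] at hv
  rcases hj.eq_or_lt with rfl | hlt
  · simp [hv]
  · have : v ∈ W (k - 1) := h.intEig_le (by omega) (mem_intEig.2 hv)
    simp only [Submodule.mem_comap, LinearMap.sub_apply, hv, LinearMap.smul_apply,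
      Module.End.one_apply]
    exact sub_mem (Submodule.smul_mem _ _ this) (Submodule.smul_mem _ _ this)

theorem ActsByWeight.map_mem {D : Module.End K V} {W : ℤ → Submodule K V}
    (h : ActsByWeight D W) (hW : IsIncFilt W) {k : ℤ} {w : V} (hw : w ∈ W k) : D w ∈ W k := by
  have := add_mem (hW.1 (by omega : k - 1 ≤ k) (h k w hw)) ((W k).smul_mem (k : K) hw)
  simpa using this

theorem IsIncFilt.eq_zero_of_descends {W : ℤ → Submodule K V} (hW : IsIncFilt W) {n : ℤ} {x : V}
    (hx : x ∈ W n) (h : ∀ m ≤ n, x ∈ W m → x ∈ W (m - 1)) : x = 0 := by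
  obtain ⟨a, ha⟩ := hW.2.1
  have key : ∀ m ≤ n, x ∈ W m := fun m hm =>
    Int.leInductionDown hx (fun m hm hxm => h m hm hxm) m hm
  have := key (min a n) (min_le_right _ _)
  rwa [ha _ (min_le_left _ _), Submodule.mem_bot] at this

theorem exists_mem_map_eq_of_injOn [FiniteDimensional K V] (D : Module.End K V)
    (S : Submodule K V) (hS : ∀ x ∈ S, D x ∈ S) (hinj : ∀ x ∈ S, D x = 0 → x = 0)
    {y : V} (hy : y ∈ S) : ∃ x ∈ S, D x = y := by
  have hi : Function.Injective (D.restrict hS) := by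
    rw [← LinearMap.ker_eq_bot, LinearMap.ker_eq_bot']
    rintro ⟨x, hx⟩ h
    exact Subtype.ext (hinj x hx (congrArg Subtype.val h))
  obtain ⟨x, hx⟩ := LinearMap.injective_iff_surjective.1 hi ⟨y, hy⟩
  exact ⟨x, x.2, congrArg Subtype.val hx⟩

theorem ActsByWeight.eq_zero_of_map_eq [CharZero K] {D : Module.End K V} {W : ℤ → Submodule K V}
    (h : ActsByWeight D W) (hW : IsIncFilt W) {k j : ℤ} (hkj : k < j) {x : V} (hx : x ∈ W k)
    (hD : D x = (j : K) • x) : x = 0 := by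
  refine hW.eq_zero_of_descends hx fun m hm hxm => ?_
  have h1 := h m x hxm
  rw [hD, ← sub_smul] at h1
  refine ((W (m - 1)).smul_mem_iff ?_).1 h1
  rw [sub_ne_zero]
  exact_mod_cast (by omega : j ≠ m)

theorem ActsByWeight.exists_sub [CharZero K] [FiniteDimensional K V] {D : Module.End K V}
    {W : ℤ → Submodule K V} (h : ActsByWeight D W) (hW : IsIncFilt W) {k j : ℤ} (hkj : k < j)
    {y : V} (hy : y ∈ W k) : ∃ x ∈ W k, D x - (j : K) • x = y := by
  refine exists_mem_map_eq_of_injOn (D - (j : K) • (1 : Module.End K V)) (W k) (fun x hx => ?_)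
    (fun x hx h0 => ?_) hy
  · exact sub_mem (h.map_mem hW hx) ((W k).smul_mem _ hx)
  · exact h.eq_zero_of_map_eq hW hkj hx (sub_eq_zero.1 h0)

theorem ActsByWeight.isGrading [CharZero K] [FiniteDimensional K V] {D : Module.End K V}
    {W : ℤ → Submodule K V} (h : ActsByWeight D W) (hW : IsIncFilt W) : IsGrading D W := by
  obtain ⟨a, ha⟩ := hW.2.1
  obtain ⟨b, hb⟩ := hW.2.2
  have hle : ∀ j, intEig D j ≤ W j := by
    intro j v hv
    rw [mem_intEig] at hv
    have key : ∀ m : ℤ, j ≤ m → v ∈ W m → v ∈ W j := by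
      intro m hm
      induction m, hm using Int.leInduction with
      | base => exact id
      | succ m hm ih =>
        intro hvm
        apply ih
        have h1 := h _ v hvm
        rw [hv, ← sub_smul, add_sub_cancel_right] at h1
        refine ((W m).smul_mem_iff ?_).1 h1
        rw [sub_ne_zero]
        exact_mod_cast (by omega : j ≠ m + 1)
    exact key (max b j) (le_max_right _ _) (by rw [hb _ (le_max_left _ _)]; trivial)
  have hge : ∀ k, W k ≤ ⨆ j ≤ k, intEig D j := by
    intro k
    rcases le_total k a with hk | hk
    · simp [ha k hk]
    induction k, hk using Int.leInduction with
    | base => simp [ha a le_rfl]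
    | succ k hk ih =>
      intro x hx
      have h1 := h _ x hx
      rw [add_sub_cancel_right] at h1
      obtain ⟨r, hr, hrx⟩ := h.exists_sub hW (by omega : k < k + 1) h1
      rw [← sub_add_cancel x r]
      refine add_mem ?_ ?_
      · refine Submodule.mem_iSup_of_mem (k + 1) (Submodule.mem_iSup_of_mem le_rfl ?_)
        rw [mem_intEig, map_sub, smul_sub]
        rw [← sub_eq_zero] at hrx ⊢
        rw [← neg_eq_zero, ← hrx]
        abel
      · exact (biSup_mono fun i (hi : i ≤ k) => by omega : (⨆ j ≤ k, intEig D j) ≤ _) (ih hr)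
  refine ⟨?_, fun k => le_antisymm (hge k) (iSup₂_le fun j hj => (hle j).trans (hW.1 hj))⟩
  rw [eq_top_iff, ← hb b le_rfl]
  exact (hge b).trans (iSup₂_le fun j _ => le_iSup _ j)

/-- The endomorphisms shifting the filtration `W` by `k`. -/
def endFilt (W : ℤ → Submodule K V) (k : ℤ) : Submodule K (Module.End K V) where
  carrier := {X | ∀ i, ∀ w ∈ W i, X w ∈ W (i + k)}
  add_mem' hX hZ i w hw := add_mem (hX i w hw) (hZ i w hw)
  zero_mem' _ _ _ := zero_mem _
  smul_mem' c _ hX i w hw := (W (i + k)).smul_mem c (hX i w hw)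

theorem mul_mem_endFilt {W : ℤ → Submodule K V} {i j : ℤ} {X Z : Module.End K V}
    (hX : X ∈ endFilt W i) (hZ : Z ∈ endFilt W j) : X * Z ∈ endFilt W (i + j) := by
  intro m w hw
  have := hX _ _ (hZ m w hw)
  rwa [show m + j + i = m + (i + j) by ring] at this

theorem adE_mem_endFilt {W : ℤ → Submodule K V} {i j : ℤ} {X Z : Module.End K V}
    (hX : X ∈ endFilt W i) (hZ : Z ∈ endFilt W j) : adE X Z ∈ endFilt W (i + j) :=
  sub_mem (mul_mem_endFilt hX hZ) (by rw [add_comm]; exact mul_mem_endFilt hZ hX)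

theorem one_mem_endFilt {W : ℤ → Submodule K V} : (1 : Module.End K V) ∈ endFilt W 0 :=
  fun i w hw => by simpa using hw

theorem IsIncFilt.endFilt {W : ℤ → Submodule K V} (hW : IsIncFilt W) :
    IsIncFilt (endFilt W) := by
  obtain ⟨a, ha⟩ := hW.2.1
  obtain ⟨b, hb⟩ := hW.2.2
  refine ⟨fun i j hij X hX m w hw => hW.1 (by omega) (hX m w hw), ⟨a - b, fun k hk => ?_⟩,
    ⟨b - a, fun k hk => ?_⟩⟩
  · rw [eq_bot_iff]
    intro X hX
    rw [Submodule.mem_bot]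
    ext v
    have := hX b v (by rw [hb b le_rfl]; trivial)
    rwa [ha _ (by omega), Submodule.mem_bot] at this
  · rw [eq_top_iff]
    rintro X - i w hw
    rcases le_total i a with hi | hi
    · rw [ha i hi, Submodule.mem_bot] at hw
      simp [hw]
    · rw [hb _ (by omega)]
      trivial

theorem ActsByWeight.mem_endFilt {D : Module.End K V} {W : ℤ → Submodule K V}
    (h : ActsByWeight D W) (hW : IsIncFilt W) : D ∈ _root_.endFilt W 0 :=
  fun i w hw => by rw [add_zero]; exact h.map_mem hW hw

theorem ActsByWeight.sub_mem_endFilt {D D' : Module.End K V} {W : ℤ → Submodule K V}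
    (h : ActsByWeight D W) (h' : ActsByWeight D' W) : D - D' ∈ endFilt W (-1) := by
  intro i w hw
  have := sub_mem (h i w hw) (h' i w hw)
  rwa [sub_sub_sub_cancel_right] at this

theorem ActsByWeight.add {D R : Module.End K V} {W : ℤ → Submodule K V}
    (h : ActsByWeight D W) (hR : R ∈ endFilt W (-1)) : ActsByWeight (D + R) W := by
  intro i w hw
  have := add_mem (h i w hw) (hR i w hw)
  rwa [sub_add_eq_add_sub] at this

theorem ActsByWeight.adE {D : Module.End K V} {W : ℤ → Submodule K V}
    (h : ActsByWeight D W) : ActsByWeight (adE D) (endFilt W) := by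
  intro k X hX i w hw
  have h1 := h _ _ (hX i w hw)
  have h2 := hX _ _ (h i w hw)
  rw [show i - 1 + k = i + (k - 1) by ring] at h2
  rw [show i + k - 1 = i + (k - 1) by ring] at h1
  have := sub_mem h1 h2
  convert this using 1
  simp only [adE_apply, LinearMap.sub_apply, Module.End.mul_apply, LinearMap.smul_apply, map_sub,
    map_smul]
  push_cast
  module

end Gradings

section Projections

variable {K V : Type} [Field K] [AddCommGroup V] [Module K V]

/-- The family `P` consists of the projections onto the integer eigenspaces of `D`. -/
structure IsEigenProj (D : Module.End K V) (P : ℤ → Module.End K V) : Prop where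
  iSup_eq_top : (⨆ j : ℤ, intEig D j) = ⊤
  apply_self : ∀ j, ∀ v ∈ intEig D j, P j v = v
  apply_ne : ∀ i j, i ≠ j → ∀ v ∈ intEig D i, P j v = 0
  apply_mem : ∀ S : Submodule K V, (∀ v ∈ S, D v ∈ S) → ∀ j, ∀ v ∈ S, P j v ∈ S
  exists_finset : ∃ s : Finset ℤ, (∀ j ∉ s, P j = 0) ∧ ∑ j ∈ s, P j = 1

theorem ext_on_intEig {U : Type} [AddCommGroup U] [Module K U] {D : Module.End K V}
    (hD : (⨆ j : ℤ, intEig D j) = ⊤) {f g : V →ₗ[K] U}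
    (h : ∀ j, ∀ v ∈ intEig D j, f v = g v) : f = g := by
  have : (⊤ : Submodule K V) ≤ LinearMap.eqLocus f g := by
    rw [← hD]
    exact iSup_le fun j v hv => h j v hv
  ext v
  exact this (Submodule.mem_top : v ∈ ⊤)

open Polynomial in
theorem exists_isEigenProj [CharZero K] [FiniteDimensional K V] {D : Module.End K V}
    (hD : (⨆ j : ℤ, intEig D j) = ⊤) : ∃ P, IsEigenProj D P := by
  classical
  have hfin : {j : ℤ | D.HasEigenvalue (j : K)}.Finite :=
    (Module.End.finite_hasEigenvalue D).preimage (Int.cast_injective.injOn)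
  let s : Finset ℤ := insert 0 hfin.toFinset
  have hs : ∀ j ∉ s, ∀ v ∈ intEig D j, v = 0 := by
    intro j hj v hv
    by_contra hv0
    apply hj
    simp only [s, Finset.mem_insert, Set.Finite.mem_toFinset, Set.mem_ofPred_eq]
    exact Or.inr (Module.End.hasEigenvalue_of_hasEigenvector
      ⟨Module.End.mem_eigenspace_iff.2 (mem_intEig.1 hv), hv0⟩)
  have hinj : Set.InjOn (fun j : ℤ => (j : K)) s := Int.cast_injective.injOn
  let P : ℤ → Module.End K V := fun j =>
    if j ∈ s then aeval D (Lagrange.basis s (fun j : ℤ => (j : K)) j) else 0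
  have hself : ∀ j, ∀ v ∈ intEig D j, P j v = v := by
    intro j v hv
    by_cases hj : j ∈ s
    · simp only [P, if_pos hj]
      rw [Module.End.aeval_apply_of_mem_apply_eq_smul (mem_intEig.1 hv),
        Lagrange.eval_basis_self hinj hj, one_smul]
    · simp [hs j hj v hv]
  have hne : ∀ i j, i ≠ j → ∀ v ∈ intEig D i, P j v = 0 := by
    intro i j hij v hv
    by_cases hj : j ∈ s
    · by_cases hi : i ∈ s
      · simp only [P, if_pos hj]
        rw [Module.End.aeval_apply_of_mem_apply_eq_smul (mem_intEig.1 hv)]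
        have := Lagrange.eval_basis_of_ne (v := fun j : ℤ => (j : K)) hij.symm hi
        rw [this, zero_smul]
      · simp [hs i hi v hv]
    · simp [P, hj]
  refine ⟨P, hD, hself, hne, ?_, s, ?_, ?_⟩
  · intro S hS j v hv
    by_cases hj : j ∈ s
    · simp only [P, if_pos hj]
      exact aeval_apply_smul_mem_of_le_comap hv _ D hS
    · simp [P, hj]
  · intro j hj
    simp [P, hj]
  · refine ext_on_intEig hD fun i v hv => ?_
    rw [LinearMap.sum_apply]
    by_cases hi : i ∈ s
    · rw [Finset.sum_eq_single_of_mem i hi fun j _ hji => hne i j hji.symm v hv, hself i v hv]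
      rfl
    · simp [hs i hi v hv]

namespace IsEigenProj

variable {D : Module.End K V} {P : ℤ → Module.End K V}

theorem mem_intEig (h : IsEigenProj D P) (j : ℤ) (v : V) : P j v ∈ intEig D j := by
  have : D * P j = (j : K) • P j := by
    refine ext_on_intEig h.iSup_eq_top fun i w hw => ?_
    rcases eq_or_ne i j with rfl | hij
    · simp [h.apply_self i w hw, _root_.mem_intEig.1 hw]
    · simp [h.apply_ne i j hij w hw]
  exact _root_.mem_intEig.2 (LinearMap.congr_fun this v)

theorem mul_self (h : IsEigenProj D P) (j : ℤ) : P j * P j = P j :=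
  LinearMap.ext fun v => h.apply_self j _ (h.mem_intEig j v)

theorem shift_mul (h : IsEigenProj D P) {X : Module.End K V} {c : ℤ}
    (hX : adE D X = (c : K) • X) (j : ℤ) : P (j + c) * X = X * P j := by
  have hmap : ∀ i, ∀ v ∈ intEig D i, X v ∈ intEig D (i + c) := by
    intro i v hv
    rw [_root_.mem_intEig] at hv ⊢
    have := LinearMap.congr_fun hX v
    simp only [adE_apply, LinearMap.sub_apply, Module.End.mul_apply, hv, map_smul,
      LinearMap.smul_apply] at this
    rw [sub_eq_iff_eq_add.1 this]
    push_cast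
    module
  refine ext_on_intEig h.iSup_eq_top fun i v hv => ?_
  rcases eq_or_ne i j with rfl | hij
  · simp [h.apply_self i v hv, h.apply_self _ _ (hmap i v hv)]
  · simp [h.apply_ne i j hij v hv, h.apply_ne (i + c) (j + c) (by simpa using hij) _ (hmap i v hv)]

theorem commute (h : IsEigenProj D P) {X : Module.End K V} (hX : D * X = X * D) (j : ℤ) :
    P j * X = X * P j := by
  have := h.shift_mul (X := X) (c := 0) (by simp [adE_apply, hX]) j
  rwa [add_zero] at this

/-- If `D x - c x` lies in a `D`-stable subspace `S`, it lies in the image of `S`. -/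
theorem exists_mem_sub_eq (h : IsEigenProj D P) [CharZero K] {S : Submodule K V}
    (hS : ∀ v ∈ S, D v ∈ S) {c : ℤ} {x : V} (hx : D x - (c : K) • x ∈ S) :
    ∃ s ∈ S, D s - (c : K) • s = D x - (c : K) • x := by
  obtain ⟨s, hs0, hs1⟩ := h.exists_finset
  have hsum : x = ∑ j ∈ s, P j x := by
    rw [← LinearMap.sum_apply, hs1]
    rfl
  have hPx : ∀ j, D (P j x) = (j : K) • P j x := fun j => _root_.mem_intEig.1 (h.mem_intEig j x)
  have hmem : ∀ j, j ≠ c → P j x ∈ S := by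
    intro j hj
    have h1 := h.apply_mem S hS j _ hx
    have h2 : P j (D x) = D (P j x) := LinearMap.congr_fun (h.commute rfl j) x
    rw [map_sub, map_smul, h2, hPx, ← sub_smul] at h1
    refine (S.smul_mem_iff ?_).1 h1
    rw [sub_ne_zero]
    exact_mod_cast hj
  refine ⟨x - P c x, ?_, ?_⟩
  · have : x - P c x = ∑ j ∈ s.erase c, P j x := by
      rw [sub_eq_iff_eq_add]
      by_cases hc : c ∈ s
      · rwa [Finset.sum_erase_add s _ hc]
      · rwa [Finset.erase_eq_of_notMem hc, hs0 c hc, LinearMap.zero_apply, add_zero]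
    rw [this]
    exact Submodule.sum_mem _ fun j hj => hmem j (Finset.ne_of_mem_erase hj)
  · rw [map_sub, hPx]
    module

theorem apply_eq_zero_of_mem (h : IsEigenProj D P) {W : ℤ → Submodule K V} (hW : IsGrading D W)
    {i j : ℤ} (hij : i < j) {v : V} (hv : v ∈ W i) : P j v = 0 := by
  suffices W i ≤ LinearMap.ker (P j) from this hv
  rw [hW.2 i]
  exact iSup₂_le fun k hk v hv => h.apply_ne k j (by omega) v hv

theorem sum_smul_eq (h : IsEigenProj D P) {s : Finset ℤ} (hs : ∑ j ∈ s, P j = 1) :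
    ∑ j ∈ s, (j : K) • P j = D := by
  conv_rhs => rw [← mul_one D, ← hs, Finset.mul_sum]
  refine Finset.sum_congr rfl fun j _ => LinearMap.ext fun v => ?_
  exact (_root_.mem_intEig.1 (h.mem_intEig j v)).symm

end IsEigenProj

end Projections

section Existence

variable {K V : Type} [Field K] [AddCommGroup V] [Module K V]

theorem IsIncFilt.exists_actsByWeight {W : ℤ → Submodule K V} (hW : IsIncFilt W) :
    ∃ D : Module.End K V, ActsByWeight D W := by
  obtain ⟨a, ha⟩ := hW.2.1
  obtain ⟨b, hb⟩ := hW.2.2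
  have hproj : ∀ j, ∃ q : Module.End K V, (∀ v, q v ∈ W j) ∧ ∀ v ∈ W j, q v = v := by
    intro j
    obtain ⟨g, hg⟩ := (W j).subtype.exists_leftInverse_of_injective (W j).ker_subtype
    exact ⟨(W j).subtype ∘ₗ g, fun v => (g v).2,
      fun v hv => congrArg Subtype.val (LinearMap.congr_fun hg ⟨v, hv⟩)⟩
  choose q hqW hq using hproj
  refine ⟨(b : K) • 1 - ∑ j ∈ Finset.Ico a b, q j, fun k w hw => ?_⟩
  rcases lt_or_ge b k with hbk | hkb
  · rw [hb (k - 1) (by omega)]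
    trivial
  rcases lt_or_ge k a with hka | hak
  · rw [ha k hka.le, Submodule.mem_bot] at hw
    simp [hw]
  have h1 : ∑ j ∈ Finset.Ico k b, q j w = ((b - k : ℤ) : K) • w := by
    rw [Finset.sum_congr rfl fun j hj => hq j w (hW.1 (Finset.mem_Ico.1 hj).1 hw),
      Finset.sum_const, Int.card_Ico, ← Nat.cast_smul_eq_nsmul K, ← Int.cast_natCast,
      Int.toNat_of_nonneg (by omega)]
  have h2 : ∑ j ∈ Finset.Ico a k, q j w ∈ W (k - 1) :=
    Submodule.sum_mem _ fun j hj => hW.1 (by have := Finset.mem_Ico.1 hj; omega) (hqW j w)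
  have h3 : ∑ j ∈ Finset.Ico a b, q j w
      = ∑ j ∈ Finset.Ico a k, q j w + ∑ j ∈ Finset.Ico k b, q j w := by
    rw [← Finset.sum_union (Finset.Ico_disjoint_Ico_consecutive a k b),
      Finset.Ico_union_Ico_eq_Ico hak hkb]
  convert neg_mem h2 using 1
  simp only [LinearMap.sub_apply, LinearMap.smul_apply, Module.End.one_apply, LinearMap.sum_apply]
  rw [h3, h1]
  push_cast
  module

theorem exists_actsByWeight_commute [CharZero K] [FiniteDimensional K V]
    {W : ℤ → Submodule K V} (hW : IsIncFilt W)
    {Y : Module.End K V} (hY : (⨆ j : ℤ, intEig (adE Y) j) = ⊤)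
    (hYW : Y ∈ endFilt W 0) : ∃ D : Module.End K V, ActsByWeight D W ∧ Y * D = D * Y := by
  obtain ⟨D, hD⟩ := hW.exists_actsByWeight
  obtain ⟨P, hP⟩ := exists_isEigenProj hY
  have hS : ∀ X ∈ endFilt W (-1), adE Y X ∈ endFilt W (-1) := fun X hX => by
    simpa using adE_mem_endFilt hYW hX
  have hYD : adE Y D ∈ endFilt W (-1) := by
    have := hD.adE 0 Y hYW
    rw [adE_apply, Int.cast_zero, zero_smul, sub_zero] at this
    rw [adE_apply, ← neg_sub]
    exact neg_mem this
  obtain ⟨r, hr, hrD⟩ := hP.exists_mem_sub_eq hS (c := 0) (x := D) (by simpa using hYD)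
  refine ⟨D + -r, hD.add (neg_mem hr), ?_⟩
  simp only [Int.cast_zero, zero_smul, sub_zero, adE_apply] at hrD
  rw [← sub_eq_zero] at hrD ⊢
  rw [← neg_eq_zero, ← hrD]
  noncomm_ring

theorem exists_trace_mul_eq [FiniteDimensional K V] (φ : Module.Dual K (Module.End K V)) :
    ∃ A : Module.End K V, ∀ X, φ X = LinearMap.trace K V (A * X) := by
  let B : Module.End K V →ₗ[K] Module.Dual K (Module.End K V) :=
    (LinearMap.mul K (Module.End K V)).compr₂ (LinearMap.trace K V)
  have hB : ∀ A X, B A X = LinearMap.trace K V (A * X) := fun _ _ => rfl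
  have hinj : Function.Injective B := by
    rw [← LinearMap.ker_eq_bot, LinearMap.ker_eq_bot']
    intro A hA
    ext v
    rw [LinearMap.zero_apply, ← Module.forall_dual_apply_eq_zero_iff K]
    intro f
    have h1 := hB A (dualTensorHom K V V (f ⊗ₜ[K] v))
    have h2 : A * dualTensorHom K V V (f ⊗ₜ[K] v) = dualTensorHom K V V (f ⊗ₜ[K] A v) := by
      ext x
      simp [dualTensorHom_apply]
    rw [hA, h2, LinearMap.trace_eq_contract_apply, contractLeft_apply] at h1
    exact h1.symm
  obtain ⟨A, hA⟩ := (LinearMap.injective_iff_surjective_of_finrank_eq_finrank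
    Subspace.dual_finrank_eq.symm).1 hinj φ
  exact ⟨A, fun X => by rw [← hA, hB]⟩

/-- The image of `ad f` is the orthogonal of the centralizer of `f` for the trace form. -/
theorem exists_commutator_eq [FiniteDimensional K V] {f H : Module.End K V}
    (h : ∀ X : Module.End K V, X * f = f * X → LinearMap.trace K V (X * H) = 0) :
    ∃ e : Module.End K V, e * f - f * e = H := by
  suffices H ∈ LinearMap.range (adE f) by
    obtain ⟨e, he⟩ := this
    refine ⟨-e, ?_⟩
    rw [← he, adE_apply]
    noncomm_ring
  by_contra hH
  obtain ⟨φ, hφH, hφ⟩ := Submodule.exists_le_ker_of_notMem hH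
  obtain ⟨A, hA⟩ := exists_trace_mul_eq φ
  refine hφH ?_
  rw [hA]
  refine h A ?_
  rw [← sub_eq_zero]
  obtain hz : ∀ X, LinearMap.trace K V ((A * f - f * A) * X) = 0 := by
    intro X
    have h1 : φ (adE f X) = 0 := hφ ⟨X, rfl⟩
    rw [hA, adE_apply, mul_sub, map_sub, ← mul_assoc, ← mul_assoc,
      LinearMap.trace_mul_comm K (A * X) f, ← mul_assoc] at h1
    rw [sub_mul, map_sub, h1]
  ext v
  rw [LinearMap.zero_apply, ← Module.forall_dual_apply_eq_zero_iff K]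
  intro g
  have h2 := hz (dualTensorHom K V V (g ⊗ₜ[K] v))
  have h3 : (A * f - f * A) * dualTensorHom K V V (g ⊗ₜ[K] v)
      = dualTensorHom K V V (g ⊗ₜ[K] (A * f - f * A) v) := by
    ext x
    simp [dualTensorHom_apply]
  rwa [h3, LinearMap.trace_eq_contract_apply, contractLeft_apply] at h2

/-- If `φ` maps the range of `a` bijectively onto that of `b`, an endomorphism commuting with `φ`
has the same trace on both. -/
theorem trace_mul_eq_of_bijOn {φ a b X : Module.End K V} (ha : a * a = a) (hb : b * b = b)
    (hφ : φ * a = b * φ) (hX : X * φ = φ * X) (hinj : ∀ v, φ (a v) = 0 → a v = 0)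
    (hsurj : ∀ v, ∃ w, φ (a w) = b v) :
    LinearMap.trace K V (X * a) = LinearMap.trace K V (X * b) := by
  obtain ⟨u₀, hu₀⟩ : ∃ u₀ : Module.End K V, (φ * a) * u₀ = b := by
    let g := (φ * a).rangeRestrict
    obtain ⟨u₀, h⟩ := Module.projective_lifting_property g
      (b.codRestrict (LinearMap.range (φ * a)) fun v => hsurj v) (LinearMap.surjective_rangeRestrict _)
    exact ⟨u₀, LinearMap.ext fun v => congrArg Subtype.val (LinearMap.congr_fun h v)⟩
  have hφu : φ * (a * u₀ * b) = b := by
    rw [← mul_assoc, ← mul_assoc, hu₀, hb]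
  have hbφ : b * φ = φ * a := hφ.symm
  have huφ : a * u₀ * b * φ = a := by
    have h1 : φ * (a * u₀ * b * φ - a) = 0 := by
      rw [mul_sub, ← mul_assoc, hφu, hbφ, sub_self]
    have h2 : a * (a * u₀ * b * φ - a) = a * u₀ * b * φ - a := by
      rw [mul_sub, ← mul_assoc, ← mul_assoc, ← mul_assoc, ha]
    ext v
    have h3 := hinj ((a * u₀ * b * φ - a) v)
    rw [← Module.End.mul_apply a, h2, ← Module.End.mul_apply φ, h1] at h3
    exact sub_eq_zero.1 (h3 rfl)
  calc LinearMap.trace K V (X * a) = LinearMap.trace K V (X * (a * u₀ * b) * φ) := by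
        rw [mul_assoc, huφ]
    _ = LinearMap.trace K V (φ * X * (a * u₀ * b)) := by
        rw [LinearMap.trace_mul_comm, ← mul_assoc]
    _ = LinearMap.trace K V (X * b) := by rw [← hX, mul_assoc, hφu]

theorem finsum_sub_mul_eq_zero_of_symm [CharZero K] (t : ℤ → K) (k : ℤ)
    (ht : ∀ j, t (2 * k - j) = t j) :
    ∑ᶠ j : ℤ, ((j - k : ℤ) : K) * t j = 0 := by
  have h1 := finsum_comp_equiv (Equiv.subLeft (2 * k)) (f := fun j : ℤ => ((j - k : ℤ) : K) * t j)
  have h2 : ∀ j : ℤ, (((Equiv.subLeft (2 * k)) j - k : ℤ) : K) * t ((Equiv.subLeft (2 * k)) j)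
      = -(((j - k : ℤ) : K) * t j) := by
    intro j
    rw [Equiv.subLeft_apply, ht]
    push_cast
    ring
  rw [finsum_congr h2, finsum_neg_distrib] at h1
  exact self_eq_neg.1 h1.symm

theorem pow_sub_pow_mem_endFilt {W : ℤ → Submodule K V} {N f : Module.End K V}
    (hN : N ∈ endFilt W 0) (hf : f ∈ endFilt W 0) (h : N - f ∈ endFilt W (-1)) (n : ℕ) :
    N ^ n - f ^ n ∈ endFilt W (-1) := by
  have hpow : ∀ n : ℕ, f ^ n ∈ endFilt W 0 := fun n => by
    induction n with
    | zero => exact one_mem_endFilt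
    | succ n ih => simpa [pow_succ] using mul_mem_endFilt ih hf
  induction n with
  | zero => simp
  | succ n ih =>
    have h1 := mul_mem_endFilt hN ih
    have h2 := mul_mem_endFilt h (hpow n)
    rw [zero_add] at h1
    rw [add_zero] at h2
    convert add_mem h1 h2 using 1
    rw [pow_succ', pow_succ']
    noncomm_ring

/-- The relative weight filtration condition splits along a pair of commuting gradings. -/
theorem IsRelWeightFilt.trace_eq {W M : ℤ → Submodule K V} {Y Y' N f X : Module.End K V}
    {P P' : ℤ → Module.End K V} (hM : IsRelWeightFilt N W M) (hYM : IsGrading Y M)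
    (hYW : Y ∈ endFilt W 0) (hY'W : IsGrading Y' W) (hP : IsEigenProj Y P)
    (hP' : IsEigenProj Y' P') (hYY' : Y * Y' = Y' * Y)
    (hYf : adE Y f = ((-2 : ℤ) : K) • f) (hY'f : Y' * f = f * Y')
    (hN : N ∈ endFilt W 0) (hf : f ∈ endFilt W 0) (hNf : N - f ∈ endFilt W (-1))
    (hX : X * f = f * X) (k : ℤ) (l : ℕ) :
    LinearMap.trace K V (X * (P' k * P (k + l))) =
      LinearMap.trace K V (X * (P' k * P (k - l))) := by
  have hPP' : ∀ j, P j * P' k = P' k * P j := fun j =>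
    hP.commute (hP'.commute hYY'.symm k).symm j
  have hidem : ∀ j, P' k * P j * (P' k * P j) = P' k * P j := fun j => by
    rw [mul_assoc, ← mul_assoc (P j), hPP', mul_assoc, hP.mul_self, ← mul_assoc, hP'.mul_self]
  have hshift : ∀ n : ℕ, ∀ j, P (j - 2 * n) * f ^ n = f ^ n * P j := by
    intro n
    induction n with
    | zero => intro j; simp
    | succ n ih =>
      intro j
      have h1 := hP.shift_mul hYf (j - 2 * n)
      rw [pow_succ', mul_assoc, ← ih j, ← mul_assoc, ← mul_assoc, ← h1,
        show j - 2 * ((n + 1 : ℕ) : ℤ) = j - 2 * n + -2 by push_cast; ring]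
  have hfl : f ^ l * (P' k * P (k + l)) = P' k * P (k - l) * f ^ l := by
    have h1 := hshift l (k + l)
    rw [show k + l - 2 * l = k - (l : ℤ) by ring] at h1
    have h2 : P' k * f ^ l = f ^ l * P' k :=
      ((show Commute (P' k) f from hP'.commute hY'f k).pow_right l).eq
    rw [mul_assoc, h1, ← mul_assoc, ← mul_assoc, h2]
  have hPW : ∀ i j, ∀ w ∈ W i, P j w ∈ W i := fun i j w hw =>
    hP.apply_mem (W i) (fun v hv => by simpa using hYW i v hv) j w hw
  have hP'W : ∀ w ∈ W (k - 1), P' k w = 0 := fun w hw =>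
    hP'.apply_eq_zero_of_mem hY'W (by omega) hw
  have hmem : ∀ j v, (P' k * P j) v ∈ M j ⊓ W k := fun j v => by
    refine ⟨?_, hY'W.intEig_le le_rfl (hP'.mem_intEig k _)⟩
    rw [← hPP']
    exact hYM.intEig_le le_rfl (hP.mem_intEig j _)
  have hpow := pow_sub_pow_mem_endFilt hN hf hNf l
  refine trace_mul_eq_of_bijOn (φ := f ^ l) (hidem _) (hidem _) hfl
    ((show Commute X f from hX).pow_right l).eq ?_ ?_
  · intro v hv
    set x := (P' k * P (k + l)) v with hx
    have hxm : x ∈ M (k + l) ⊓ W k := hmem _ v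
    have h1 := hpow k x hxm.2
    rw [LinearMap.sub_apply, hv, sub_zero] at h1
    have h2 := (hM.2 k l).2 ⟨hxm, Submodule.mem_sup_right h1⟩
    obtain ⟨m, hm, w, hw, hmw⟩ := Submodule.mem_sup.1 h2
    have h3 : P' k (P (k + l) x) = x := by
      rw [hx, ← Module.End.mul_apply, ← Module.End.mul_apply, hidem]
    rw [← h3, ← hmw, map_add, hP.apply_eq_zero_of_mem hYM (by omega) hm.1, zero_add,
      hP'W _ (hPW _ _ w hw)]
  · intro v
    have h1 := (hM.2 k l).1 (hmem (k - l) v)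
    obtain ⟨_, ⟨x, hx, rfl⟩, y, hy, hxy⟩ := Submodule.mem_sup.1 h1
    obtain ⟨m, hm, w, hw, rfl⟩ := Submodule.mem_sup.1 hy
    refine ⟨x, ?_⟩
    have h2 : (P' k * P (k - l)) ((P' k * P (k - l)) v) = (P' k * P (k - l)) v := by
      rw [← Module.End.mul_apply, hidem]
    have h3 : (P' k * P (k - l)) ((N ^ l - f ^ l) x) = 0 :=
      hP'W _ (hPW _ _ _ (hpow k x hx.2))
    have h4 : (P' k * P (k - l)) m = 0 := by
      rw [Module.End.mul_apply, hP.apply_eq_zero_of_mem hYM (by omega) hm.1, map_zero]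
    have h5 : (P' k * P (k - l)) w = 0 := hP'W _ (hPW _ _ w hw)
    rw [← h2, ← hxy, map_add, map_add, h4, h5, add_zero, add_zero, ← Module.End.mul_apply (f ^ l),
      hfl, Module.End.mul_apply, ← sub_eq_zero, ← map_sub, ← neg_eq_zero, ← map_neg, neg_sub]
    exact h3

/-- Two commuting gradings, of `W` and of its relative weight filtration `M`, differ by the
semisimple member of an `sl₂`-triple whose lowering operator is `f`. -/
theorem IsRelWeightFilt.exists_raising [CharZero K] [FiniteDimensional K V]
    {W M : ℤ → Submodule K V} {Y Y' N f : Module.End K V}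
    (hM : IsRelWeightFilt N W M) (hYM : IsGrading Y M)
    (hadY : (⨆ j : ℤ, intEig (adE Y) j) = ⊤) (hadY' : (⨆ j : ℤ, intEig (adE Y') j) = ⊤)
    (hYW : Y ∈ endFilt W 0) (hY'W : IsGrading Y' W) (hYY' : Y * Y' = Y' * Y)
    (hYf : adE Y f = ((-2 : ℤ) : K) • f) (hY'f : Y' * f = f * Y')
    (hN : N ∈ endFilt W 0) (hf : f ∈ endFilt W 0) (hNf : N - f ∈ endFilt W (-1)) :
    ∃ e : Module.End K V, adE Y e = (2 : K) • e ∧ adE Y' e = 0 ∧ e * f - f * e = Y - Y' := by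
  obtain ⟨P, hP⟩ := exists_isEigenProj hYM.1
  obtain ⟨P', hP'⟩ := exists_isEigenProj hY'W.1
  obtain ⟨s, hs0, hs⟩ := hP.exists_finset
  obtain ⟨s', -, hs'⟩ := hP'.exists_finset
  have hH : Y - Y' = ∑ k ∈ s', ∑ j ∈ s, ((j - k : ℤ) : K) • (P' k * P j) := by
    have h1 : Y = ∑ k ∈ s', ∑ j ∈ s, P' k * (j : K) • P j := by
      rw [← Finset.sum_mul_sum, hs', one_mul, hP.sum_smul_eq hs]
    have h2 : Y' = ∑ k ∈ s', ∑ j ∈ s, ((k : K) • P' k) * P j := by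
      rw [← Finset.sum_mul_sum, hs, mul_one, hP'.sum_smul_eq hs']
    conv_lhs => rw [h1, h2]
    rw [← Finset.sum_sub_distrib]
    refine Finset.sum_congr rfl fun k _ => ?_
    rw [← Finset.sum_sub_distrib]
    refine Finset.sum_congr rfl fun j _ => ?_
    rw [mul_smul_comm, smul_mul_assoc, ← sub_smul]
    push_cast
    rfl
  obtain ⟨e₀, he₀⟩ : ∃ e : Module.End K V, e * f - f * e = Y - Y' := by
    refine exists_commutator_eq fun X hX => ?_
    rw [hH, Finset.mul_sum, map_sum]
    refine Finset.sum_eq_zero fun k _ => ?_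
    have key := hM.trace_eq hYM hYW hY'W hP hP' hYY' hYf hY'f hN hf hNf hX k
    rw [← finsum_sub_mul_eq_zero_of_symm
      (fun j => LinearMap.trace K V (X * (P' k * P j))) k fun j => ?_]
    · rw [finsum_eq_sum_of_support_subset (s := s)]
      · simp [Finset.mul_sum, map_sum]
      · intro j hj
        by_contra hjs
        exact hj (by simp [hs0 j hjs])
    · rcases le_total k j with h | h
      · obtain ⟨l, rfl⟩ := Int.le.dest h
        rw [show 2 * k - (k + l) = k - (l : ℤ) by ring, key]
      · obtain ⟨l, hl⟩ := Int.le.dest h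
        rw [show 2 * k - j = k + l by omega, show j = k - l by omega, key]
  obtain ⟨Q, hQ⟩ := exists_isEigenProj hadY
  obtain ⟨Q', hQ'⟩ := exists_isEigenProj hadY'
  have hfY : adE f Y = (2 : K) • f := by
    rw [adE_swap, hYf]
    push_cast
    module
  have hfY' : adE f Y' = 0 := adE_eq_zero.2 hY'f.symm
  have hYY'0 : adE Y Y' = 0 := adE_eq_zero.2 hYY'
  have hfe₀ : adE f e₀ = -(Y - Y') := by rw [← he₀, adE_apply, neg_sub]
  have hS : ∀ X, adE f X = 0 → adE f (adE Y X) = 0 := fun X hX => by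
    rw [adE_adE, hfY, adE_smul_left, hX, map_zero, smul_zero, add_zero]
  obtain ⟨z, hz, hze⟩ := hQ.exists_mem_sub_eq (S := LinearMap.ker (adE f)) (c := 2) (x := e₀) hS (by
    have h1 : adE Y (-(Y - Y')) = 0 := by
      rw [map_neg, map_sub, hYY'0, adE_eq_zero.2 rfl, sub_zero, neg_zero]
    rw [LinearMap.mem_ker, map_sub, map_smul, adE_adE, hfY, adE_smul_left, hfe₀, h1]
    push_cast
    module)
  obtain ⟨e₁, rfl⟩ : ∃ e₁, e₀ = e₁ + z := ⟨e₀ - z, by abel⟩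
  have hYe₁ : adE Y e₁ = (2 : K) • e₁ := by
    rw [map_add, ← sub_eq_zero] at hze
    rw [← sub_eq_zero, ← neg_eq_zero, ← hze]
    push_cast
    module
  rw [map_add, LinearMap.mem_ker.1 hz, add_zero] at hfe₀
  have hY'0 : adE Y' Y = 0 := adE_eq_zero.2 hYY'.symm
  have hmem : ∀ X, X ∈ LinearMap.ker (adE f) ⊓
      LinearMap.ker (adE Y - (2 : K) • (1 : Module.End K (Module.End K V))) ↔
      adE f X = 0 ∧ adE Y X = (2 : K) • X := fun X => by
    simp [Submodule.mem_inf, sub_eq_zero]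
  obtain ⟨y, hy, hye⟩ := hQ'.exists_mem_sub_eq (c := 0) (x := e₁)
    (S := LinearMap.ker (adE f) ⊓
      LinearMap.ker (adE Y - (2 : K) • (1 : Module.End K (Module.End K V))))
    (fun X hX => by
      rw [hmem] at hX ⊢
      refine ⟨?_, ?_⟩
      · rw [adE_adE, hfY', hX.1]
        simp [adE_apply]
      · rw [adE_adE, hYY'0, hX.2]
        simp [adE_apply])
    (by
      rw [Int.cast_zero, zero_smul, sub_zero, hmem]
      refine ⟨?_, ?_⟩
      · rw [adE_adE, hfY', hfe₀, map_neg, map_sub, hY'0, adE_eq_zero.2 rfl]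
        simp [adE_apply]
      · rw [adE_adE, hYY'0, hYe₁]
        simp [adE_apply])
  obtain ⟨hy1, hy2⟩ := (hmem y).1 hy
  refine ⟨e₁ - y, ?_, ?_, ?_⟩
  · rw [map_sub, hYe₁, hy2, smul_sub]
  · rw [Int.cast_zero, zero_smul, sub_zero, zero_smul, sub_zero] at hye
    rw [map_sub, hye, sub_self]
  · have h1 : adE f (e₁ - y) = -(Y - Y') := by rw [map_sub, hfe₀, hy1, sub_zero]
    rw [adE_apply] at h1
    rw [← neg_sub, h1, neg_neg]

end Existence

section Triples

variable {K V : Type} [Field K] [AddCommGroup V] [Module K V]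

/-- `Y'` acts by weight on `W`, commutes with `Y`, and `(e, Y - Y', f)` is a standard triple
whose outer members commute with `Y'`. -/
structure IsRelTriple (W : ℤ → Submodule K V) (Y Y' e f : Module.End K V) : Prop where
  acts : ActsByWeight Y' W
  comm : adE Y Y' = 0
  raise : adE Y e = (2 : K) • e
  lower : adE Y f = (-2 : K) • f
  raise_comm : adE Y' e = 0
  lower_comm : adE Y' f = 0
  bracket : adE e f = Y - Y'

theorem IsIncFilt.exists_endFilt_neg_eq_bot {W : ℤ → Submodule K V} (hW : IsIncFilt W) :
    ∃ n : ℕ, _root_.endFilt W (-n) = ⊥ := by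
  obtain ⟨a, ha⟩ := hW.endFilt.2.1
  exact ⟨a.natAbs, ha _ (by omega)⟩

theorem ActsByWeight.mem_endFilt_of_adE_eq_zero [CharZero K] [FiniteDimensional K V]
    {W : ℤ → Submodule K V} {D X : Module.End K V} (h : ActsByWeight D W) (hW : IsIncFilt W)
    (hX : _root_.adE D X = 0) : X ∈ _root_.endFilt W 0 :=
  (h.adE.isGrading hW.endFilt).intEig_le le_rfl (mem_intEig.2 (by simp [hX]))

theorem ActsByWeight.eq_zero_of_adE_eq_zero [CharZero K]
    {W : ℤ → Submodule K V} {D X : Module.End K V} (h : ActsByWeight D W) (hW : IsIncFilt W)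
    (hXW : X ∈ _root_.endFilt W (-1)) (hX : _root_.adE D X = 0) : X = 0 :=
  h.adE.eq_zero_of_map_eq hW.endFilt (by omega : (-1 : ℤ) < 0) hXW (by simp [hX])

theorem IsRelTriple.adE_adE_eq_zero {W : ℤ → Submodule K V} {Y Y' e f : Module.End K V}
    (h : IsRelTriple W Y Y' e f) {X : Module.End K V} (hX : adE Y X = 0) :
    adE Y (adE e (adE f X)) = 0 := by
  rw [adE_adE Y e, adE_adE Y f, hX, map_zero, h.lower, h.raise, adE_smul_left, adE_smul_left,
    zero_add, map_smul, ← add_smul]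
  norm_num

namespace IsRelTriple

variable [CharZero K] [FiniteDimensional K V] {W : ℤ → Submodule K V}
  {Y Y' e f : Module.End K V}

theorem raise_mem (h : IsRelTriple W Y Y' e f) (hW : IsIncFilt W) : e ∈ endFilt W 0 :=
  h.acts.mem_endFilt_of_adE_eq_zero hW h.raise_comm

theorem lower_mem (h : IsRelTriple W Y Y' e f) (hW : IsIncFilt W) : f ∈ endFilt W 0 :=
  h.acts.mem_endFilt_of_adE_eq_zero hW h.lower_comm

/-- The `sl₂`-weights occurring in the kernel of `ad e ∘ ad f` are not positive. -/
theorem mem_of_adE_adE_mem (h : IsRelTriple W Y Y' e f) (hW : IsIncFilt W) {x : Module.End K V}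
    {k w : ℤ} (hkw : k < w) (hx : x ∈ endFilt W k) (hYx : adE Y x = (w : K) • x)
    (hxx : adE e (adE f x) ∈ endFilt W (k - 1)) : x ∈ endFilt W (k - 1) := by
  have hstab : ∀ {A X : Module.End K V} {i : ℤ}, A ∈ endFilt W 0 → X ∈ endFilt W i →
      adE A X ∈ endFilt W i := fun hA hX => by simpa using adE_mem_endFilt hA hX
  have hpow : ∀ m : ℕ, ∀ {X : Module.End K V} {i : ℤ}, X ∈ endFilt W i →
      (adE e ^ m) X ∈ endFilt W i := by
    intro m X i hX
    induction m with
    | zero => simpa using hX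
    | succ m ih => rw [pow_succ', Module.End.mul_apply]; exact hstab (h.raise_mem hW) ih
  have hwt : ∀ m : ℕ, adE Y ((adE e ^ m) x) = ((w + 2 * m : ℤ) : K) • (adE e ^ m) x := by
    intro m
    induction m with
    | zero => simpa using hYx
    | succ m ih =>
      rw [pow_succ', Module.End.mul_apply, adE_adE, ih, h.raise, adE_smul_left, map_smul]
      push_cast
      module
  have hcomm : ∀ X, adE e (adE f X) = adE f (adE e X) + (adE Y X - adE Y' X) := fun X => by
    rw [adE_adE, h.bracket, adE_sub_left]
  have hdiff : ∀ m : ℕ, (adE e ^ (m + 1)) (adE f x) - adE f ((adE e ^ (m + 1)) x) -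
      (((m + 1) * (w - k + m) : ℤ) : K) • (adE e ^ m) x ∈ endFilt W (k - 1) := by
    intro m
    induction m with
    | zero =>
      have := neg_mem (h.acts.adE k x hx)
      convert this using 1
      simp only [zero_add, pow_one, pow_zero, Module.End.one_apply]
      rw [hcomm, hYx]
      push_cast
      module
    | succ m ih =>
      have h1 := hstab (h.raise_mem hW) ih
      have h2 := sub_mem h1 (h.acts.adE k _ (hpow (m + 1) hx))
      convert h2 using 1
      rw [pow_succ' (adE e) (m + 1), Module.End.mul_apply, Module.End.mul_apply, map_sub, map_sub,
        map_smul, hcomm ((adE e ^ (m + 1)) x), hwt, ← Module.End.mul_apply (adE e) (adE e ^ m),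
        ← pow_succ']
      push_cast
      module
  obtain ⟨m, hm⟩ : ∃ m : ℕ, (adE e ^ m) x ∈ endFilt W (k - 1) := by
    have hinj : Function.Injective fun m : ℕ => ((w + 2 * m : ℤ) : K) := fun a b hab => by
      have := Int.cast_injective hab
      omega
    obtain ⟨m, hm⟩ := ((Module.End.finite_hasEigenvalue (adE Y)).preimage
      hinj.injOn).exists_notMem
    refine ⟨m, ?_⟩
    by_contra hne
    refine hm (Module.End.hasEigenvalue_of_hasEigenvector
      ⟨Module.End.mem_eigenspace_iff.2 (hwt m), fun h0 => hne ?_⟩)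
    rw [h0]
    exact zero_mem _
  induction m with
  | zero => simpa using hm
  | succ m ih =>
    refine ih ?_
    have h1 : (adE e ^ (m + 1)) (adE f x) ∈ endFilt W (k - 1) := by
      rw [pow_succ, Module.End.mul_apply]
      exact hpow m hxx
    have h2 := sub_mem (sub_mem h1 (hstab (h.lower_mem hW) hm)) (hdiff m)
    rw [sub_sub_cancel] at h2
    refine ((endFilt W (k - 1)).smul_mem_iff ?_).1 h2
    rw [Int.cast_ne_zero]
    exact mul_ne_zero (by omega) (by omega)

theorem exists_adE_adE_eq (h : IsRelTriple W Y Y' e f) (hW : IsIncFilt W) {r : Module.End K V}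
    {k : ℤ} (hk : k < 0) (hr : r ∈ endFilt W k) (hYr : adE Y r = 0) :
    ∃ x ∈ endFilt W k, adE Y x = 0 ∧ adE e (adE f x) = r := by
  have hstab : ∀ x ∈ endFilt W k ⊓ LinearMap.ker (adE Y),
      (adE e * adE f) x ∈ endFilt W k ⊓ LinearMap.ker (adE Y) := fun x hx => by
    refine ⟨?_, h.adE_adE_eq_zero hx.2⟩
    have := adE_mem_endFilt (h.raise_mem hW) (adE_mem_endFilt (h.lower_mem hW) hx.1)
    rwa [zero_add, zero_add] at this
  have hinj : ∀ x ∈ endFilt W k ⊓ LinearMap.ker (adE Y), (adE e * adE f) x = 0 → x = 0 := by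
    intro x hx hx0
    refine hW.endFilt.eq_zero_of_descends hx.1 fun m hm hxm => ?_
    refine h.mem_of_adE_adE_mem hW (by omega : m < 0) hxm ?_ ?_
    · rw [LinearMap.mem_ker.1 hx.2, Int.cast_zero, zero_smul]
    · rw [← Module.End.mul_apply, hx0]
      exact zero_mem _
  obtain ⟨x, hx, hxr⟩ := exists_mem_map_eq_of_injOn _ _ hstab hinj (y := r) ⟨hr, hYr⟩
  exact ⟨x, hx.1, hx.2, hxr⟩

end IsRelTriple

theorem mem_endFilt_zero_of_mul_eq_one [FiniteDimensional K V] {W : ℤ → Submodule K V}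
    {g h : Module.End K V} (hg : g ∈ endFilt W 0) (hhg : h * g = 1) : h ∈ endFilt W 0 := by
  have hh : ∀ x, h (g x) = x := fun x => LinearMap.congr_fun hhg x
  intro i w hw
  obtain ⟨x, hx, rfl⟩ := exists_mem_map_eq_of_injOn g (W i)
    (fun x hx => by simpa using hg i x hx) (fun x _ hx => by rw [← hh x, hx, map_zero]) hw
  rwa [hh, add_zero]

theorem isNilpotent_of_mem_endFilt {W : ℤ → Submodule K V} (hW : IsIncFilt W)
    {x : Module.End K V} (hx : x ∈ endFilt W (-1)) : IsNilpotent x := by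
  obtain ⟨n, hn⟩ := hW.exists_endFilt_neg_eq_bot
  refine ⟨n, ?_⟩
  rw [← Submodule.mem_bot K, ← hn]
  clear hn
  induction n with
  | zero => simpa using one_mem_endFilt
  | succ n ih =>
    have := mul_mem_endFilt ih hx
    rw [pow_succ]
    convert this using 2
    push_cast
    ring

theorem adE_conj {g h : Module.End K V} (hgh : g * h = 1) (A X : Module.End K V) :
    adE (h * A * g) (h * X * g) = h * adE A X * g := by
  have : ∀ A B : Module.End K V, h * A * g * (h * B * g) = h * (A * B) * g := fun A B => by
    rw [mul_assoc (h * A) g, mul_assoc h B g, ← mul_assoc g h, hgh, one_mul]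
    simp only [mul_assoc]
  rw [adE_apply, adE_apply, this, this, mul_sub, sub_mul]

namespace IsRelTriple

variable {W : ℤ → Submodule K V} {Y Y' e f g h : Module.End K V}

theorem conj (ht : IsRelTriple W Y Y' e f) (hW : IsIncFilt W) (hgh : g * h = 1)
    (hhg : h * g = 1) (hh : h ∈ endFilt W 0) (hg1 : g - 1 ∈ endFilt W (-1))
    (hYg : adE Y g = 0) : IsRelTriple W Y (h * Y' * g) (h * e * g) (h * f * g) := by
  have hY : h * Y * g = Y := by
    rw [mul_assoc, adE_eq_zero.1 hYg, ← mul_assoc, hhg, one_mul]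
  have hYconj : ∀ X, adE Y (h * X * g) = h * adE Y X * g := fun X => by
    conv_lhs => rw [← hY]
    exact adE_conj hgh Y X
  have hsmul : ∀ (c : K) (X : Module.End K V), h * (c • X) * g = c • (h * X * g) :=
    fun c X => by rw [mul_smul_comm, smul_mul_assoc]
  refine ⟨?_, ?_, ?_, ?_, ?_, ?_, ?_⟩
  · have h1 := adE_mem_endFilt (ht.acts.mem_endFilt hW) hg1
    have h2 := mul_mem_endFilt hh h1
    rw [zero_add, zero_add] at h2
    have h3 : h * Y' * g = Y' + h * adE Y' (g - 1) := by
      have h4 : adE Y' (g - 1) = Y' * g - g * Y' := by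
        rw [adE_apply]
        noncomm_ring
      rw [h4, mul_sub, ← mul_assoc h g, hhg, one_mul, mul_assoc, add_sub_cancel]
    rw [h3]
    exact ht.acts.add h2
  · rw [hYconj, ht.comm, mul_zero, zero_mul]
  · rw [hYconj, ht.raise, hsmul]
  · rw [hYconj, ht.lower, hsmul]
  · rw [adE_conj hgh, ht.raise_comm, mul_zero, zero_mul]
  · rw [adE_conj hgh, ht.lower_comm, mul_zero, zero_mul]
  · rw [adE_conj hgh, ht.bracket, mul_sub, sub_mul, hY]

variable [CharZero K] [FiniteDimensional K V] {N : Module.End K V}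

/-- Conjugation improves by one step the extent to which `e` commutes with `N - f`. -/
theorem exists_improve (ht : IsRelTriple W Y Y' e f) (hW : IsIncFilt W)
    (hYN : adE Y N = (-2 : K) • N) (hNf : N - f ∈ endFilt W (-1)) {n : ℕ}
    (hn : adE e (N - f) ∈ endFilt W (-(n + 1 : ℕ))) :
    ∃ Y₁ e₁ f₁, IsRelTriple W Y Y₁ e₁ f₁ ∧ N - f₁ ∈ endFilt W (-1) ∧
      adE e₁ (N - f₁) ∈ endFilt W (-(n + 1 + 1 : ℕ)) := by
  have hYr : adE Y (adE e (N - f)) = 0 := by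
    rw [adE_adE, ht.raise, map_sub, hYN, ht.lower, ← smul_sub, map_smul, adE_smul_left, ← add_smul]
    norm_num
  obtain ⟨x, hx, hYx, hxr⟩ := ht.exists_adE_adE_eq hW (by omega) hn hYr
  have hx1 : x ∈ endFilt W (-1) := hW.endFilt.1 (by push_cast; omega) hx
  have hx0 : x ∈ endFilt W 0 := hW.endFilt.1 (by omega) hx1
  obtain ⟨⟨g, h, hgh, hhg⟩, hg⟩ := (isNilpotent_of_mem_endFilt hW hx1).isUnit_one_add
  change g = 1 + x at hg
  have hg0 : g ∈ endFilt W 0 := hg ▸ add_mem one_mem_endFilt hx0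
  have hh0 := mem_endFilt_zero_of_mul_eq_one hg0 hhg
  have hg1 : g - 1 ∈ endFilt W (-1) := by rwa [hg, add_sub_cancel_left]
  have hYg : adE Y g = 0 := by
    rw [hg, map_add, hYx, add_zero]
    exact adE_eq_zero.2 (by simp)
  have hN : N = h * (g * N * h) * g := by
    rw [← mul_assoc, ← mul_assoc, hhg, one_mul, mul_assoc, hhg, mul_one]
  have hh1 : h - 1 = -(x * h) := by
    have : (1 + x) * h = 1 := hg ▸ hgh
    rw [add_mul, one_mul] at this
    rw [← this]
    abel
  have hgN : g * N * h = N + adE x N * h := by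
    have : g * N = N * g + adE x N := by
      rw [hg, adE_apply, add_mul, mul_add]
      simp
    rw [this, add_mul, mul_assoc, hgh, mul_one]
  have hconj : ∀ {X : Module.End K V} {i : ℤ}, X ∈ endFilt W i → h * X * g ∈ endFilt W i :=
    fun hX => by simpa using mul_mem_endFilt (mul_mem_endFilt hh0 hX) hg0
  have hN0 : N ∈ endFilt W 0 := by
    rw [← sub_add_cancel N f]
    exact add_mem (hW.endFilt.1 (by omega) hNf) (ht.lower_mem hW)
  have hsub : N - h * f * g = h * (g * N * h - f) * g := by
    conv_lhs => rw [hN]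
    rw [mul_sub, sub_mul]
  refine ⟨_, _, _, ht.conj hW hgh hhg hh0 hg1 hYg, ?_, ?_⟩
  · rw [hsub, hgN, add_sub_right_comm]
    refine hconj (add_mem hNf ?_)
    simpa using mul_mem_endFilt (adE_mem_endFilt hx1 hN0) hh0
  · rw [hsub, adE_conj hgh, hgN]
    refine hconj ?_
    have h1 : N + adE x N * h - f = (N - f) - adE f x + (adE x (N - f) - adE x N * x * h) := by
      rw [mul_assoc, ← neg_eq_iff_eq_neg.2 hh1, adE_swap f x, map_sub, mul_neg, mul_sub, mul_one]
      abel
    rw [h1, map_add, map_sub, hxr, sub_self, zero_add]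
    have h2 := adE_mem_endFilt hx hNf
    have h3 := mul_mem_endFilt (mul_mem_endFilt (adE_mem_endFilt hx hN0) hx1) hh0
    have h4 : -((n + 1 : ℕ) : ℤ) + -1 = -((n + 1 + 1 : ℕ) : ℤ) := by push_cast; ring
    rw [h4] at h2
    rw [add_zero, add_zero, h4] at h3
    simpa using adE_mem_endFilt (ht.raise_mem hW) (sub_mem h2 h3)

theorem exists_commute (ht : IsRelTriple W Y Y' e f) (hW : IsIncFilt W)
    (hYN : adE Y N = (-2 : K) • N) (hNf : N - f ∈ endFilt W (-1)) :
    ∃ Y₁ e₁ f₁, IsRelTriple W Y Y₁ e₁ f₁ ∧ N - f₁ ∈ endFilt W (-1) ∧ adE e₁ (N - f₁) = 0 := by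
  have key : ∀ n : ℕ, ∃ Y₁ e₁ f₁, IsRelTriple W Y Y₁ e₁ f₁ ∧ N - f₁ ∈ endFilt W (-1) ∧
      adE e₁ (N - f₁) ∈ endFilt W (-(n + 1 : ℕ)) := by
    intro n
    induction n with
    | zero =>
      refine ⟨Y', e, f, ht, hNf, ?_⟩
      simpa using adE_mem_endFilt (ht.raise_mem hW) hNf
    | succ n ih =>
      obtain ⟨Y₁, e₁, f₁, h1, h2, h3⟩ := ih
      exact h1.exists_improve hW hYN h2 h3
  obtain ⟨n, hn⟩ := hW.exists_endFilt_neg_eq_bot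
  obtain ⟨Y₁, e₁, f₁, h1, h2, h3⟩ := key n
  refine ⟨Y₁, e₁, f₁, h1, h2, ?_⟩
  rw [← Submodule.mem_bot K, ← hn]
  exact hW.endFilt.1 (by omega) h3

theorem grading_unique {Y₁ e₁ f₁ Y₂ e₂ f₂ : Module.End K V} (h₁ : IsRelTriple W Y Y₁ e₁ f₁)
    (h₂ : IsRelTriple W Y Y₂ e₂ f₂) (hW : IsIncFilt W) (hN₁ : N - f₁ ∈ endFilt W (-1))
    (hc₁ : adE e₁ (N - f₁) = 0) (hc₂ : adE e₂ (N - f₂) = 0) : Y₁ = Y₂ := by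
  obtain ⟨d, rfl⟩ : ∃ d, Y₂ = Y₁ + d := ⟨Y₂ - Y₁, by abel⟩
  obtain ⟨x, rfl⟩ : ∃ x, e₂ = e₁ + x := ⟨e₂ - e₁, by abel⟩
  have hd1 : d ∈ endFilt W (-1) := by simpa using h₂.acts.sub_mem_endFilt h₁.acts
  have hYd : adE Y d = 0 := by simpa [h₁.comm] using h₂.comm
  have hYx : adE Y x = (2 : K) • x := by
    have := h₂.raise
    rw [map_add, h₁.raise, smul_add] at this
    exact add_left_cancel this
  have hx0 : x ∈ endFilt W 0 := by simpa using sub_mem (h₂.raise_mem hW) (h₁.raise_mem hW)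
  have hNx : adE N x = d := by
    have h1 : adE (e₁ + x) N = Y - (Y₁ + d) := by
      rw [← h₂.bracket, ← sub_eq_zero, ← map_sub, hc₂]
    have h2 : adE e₁ N = Y - Y₁ := by rw [← h₁.bracket, ← sub_eq_zero, ← map_sub, hc₁]
    have h3 : adE (e₁ + x) N = adE e₁ N - adE N x := by
      simp only [adE_apply]
      noncomm_ring
    rw [h1, h2] at h3
    have : adE N x = Y - Y₁ - (Y - (Y₁ + d)) := by rw [h3]; abel
    rw [this]
    abel
  have hY₁x : adE Y₁ x = adE (e₁ + x) d := by
    have h1 := h₂.raise_comm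
    have h2 : adE (Y₁ + d) (e₁ + x) = adE Y₁ e₁ + adE Y₁ x - adE (e₁ + x) d := by
      simp only [adE_apply]
      noncomm_ring
    rw [h1, h₁.raise_comm, zero_add] at h2
    exact (sub_eq_zero.1 h2.symm)
  have hfx : ∀ {i : ℤ}, x ∈ endFilt W i → adE f₁ x - d ∈ endFilt W (i - 1) := by
    intro i hi
    have h1 := adE_mem_endFilt hN₁ hi
    rw [adE_sub_left, hNx, show -1 + i = i - 1 by ring] at h1
    rw [← neg_sub d]
    exact neg_mem h1
  have he₁ := h₁.raise_mem hW
  have hf₁ := h₁.lower_mem hW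
  have hx1 : x ∈ endFilt W (0 - 1) := by
    refine h₁.mem_of_adE_adE_mem hW (by omega : (0 : ℤ) < 2) hx0 (by simpa using hYx) ?_
    have h1 := add_mem (hfx hx0) hd1
    rw [sub_add_cancel] at h1
    simpa using adE_mem_endFilt he₁ h1
  have key : ∀ n : ℕ, d ∈ endFilt W (-(n + 1 : ℕ)) ∧ x ∈ endFilt W (-(n + 1 : ℕ)) := by
    intro n
    induction n with
    | zero => exact ⟨by simpa using hd1, by simpa using hx1⟩
    | succ n ih =>
      obtain ⟨hd, hx⟩ := ih
      set k : ℤ := -((n + 1 : ℕ) : ℤ) with hk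
      have hk' : -((n + 1 + 1 : ℕ) : ℤ) = k - 1 := by rw [hk]; push_cast; ring
      rw [hk']
      have hle : k ≤ -1 := by rw [hk]; push_cast; omega
      have hxd : adE x d ∈ endFilt W (k - 1) :=
        hW.endFilt.1 (by omega) (adE_mem_endFilt hx hd)
      have hed : adE e₁ d - (k : K) • x ∈ endFilt W (k - 1) := by
        have h1 := sub_mem (h₁.acts.adE k x hx) hxd
        rw [hY₁x] at h1
        convert h1 using 1
        simp only [adE_apply]
        noncomm_ring
      have hd' : d ∈ endFilt W (k - 1) := by
        refine h₁.mem_of_adE_adE_mem hW (by omega : k < 0) hd (by simpa using hYd) ?_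
        rw [adE_adE, h₁.bracket, adE_sub_left, hYd, zero_sub]
        have h1 := adE_mem_endFilt hf₁ hed
        rw [zero_add, map_sub, map_smul] at h1
        have h2 := (endFilt W (k - 1)).smul_mem (k : K) (hfx hx)
        have h3 := sub_mem (add_mem h1 h2) (h₁.acts.adE k d hd)
        convert h3 using 1
        module
      refine ⟨hd', ?_⟩
      have h1 := adE_mem_endFilt he₁ hd'
      rw [zero_add] at h1
      have h2 := sub_mem h1 hed
      rw [sub_sub_cancel] at h2
      exact ((endFilt W (k - 1)).smul_mem_iff (Int.cast_ne_zero.2 (by omega))).1 h2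
  obtain ⟨n, hn⟩ := hW.exists_endFilt_neg_eq_bot
  have h1 : d ∈ endFilt W (-n) := hW.endFilt.1 (by omega) (key n).1
  rw [hn, Submodule.mem_bot] at h1
  rw [h1, add_zero]

end IsRelTriple

end Triples

section ZeroComponent

variable {K V : Type} [Field K] [CharZero K] [AddCommGroup V] [Module K V]
  {W : ℤ → Submodule K V} {Y Y' N f : Module.End K V}

theorem ActsByWeight.adE_zeroComponent (h : ActsByWeight Y' W) (hW : IsIncFilt W)
    (hY : Y ∈ _root_.endFilt W 0) (hYY' : _root_.adE Y Y' = 0)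
    (hYN : _root_.adE Y N = (-2 : K) • N) (hf : _root_.adE Y' f = 0)
    (hNf : N - f ∈ _root_.endFilt W (-1)) : _root_.adE Y f = (-2 : K) • f := by
  rw [← sub_eq_zero]
  refine h.eq_zero_of_adE_eq_zero hW ?_ ?_
  · have h1 := adE_mem_endFilt hY hNf
    rw [zero_add] at h1
    have h2 := sub_mem ((_root_.endFilt W (-1)).smul_mem (-2 : K) hNf) h1
    convert h2 using 1
    rw [map_sub, hYN]
    module
  · rw [map_sub, map_smul, adE_adE, hf, adE_swap Y', hYY']
    simp [adE_apply]

variable [FiniteDimensional K V]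

theorem ActsByWeight.exists_zeroComponent (h : ActsByWeight Y' W) (hW : IsIncFilt W)
    (hN : N ∈ _root_.endFilt W 0) :
    ∃ f, _root_.adE Y' f = 0 ∧ N - f ∈ _root_.endFilt W (-1) := by
  obtain ⟨r, hr, hrN⟩ := h.adE.exists_sub hW.endFilt (by omega : (-1 : ℤ) < 0)
    (by simpa using h.adE 0 N hN : _root_.adE Y' N ∈ _root_.endFilt W (-1))
  refine ⟨N - r, ?_, by simpa using hr⟩
  rw [Int.cast_zero, zero_smul, sub_zero] at hrN
  rw [map_sub, hrN, sub_self]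

theorem ActsByWeight.isZeroComponent_iff (h : ActsByWeight Y' W) (hW : IsIncFilt W)
    (hN : N ∈ _root_.endFilt W 0) :
    IsZeroComponent Y' N f ↔ _root_.adE Y' f = 0 ∧ N - f ∈ _root_.endFilt W (-1) := by
  have hgr := h.adE.isGrading hW.endFilt
  have hle : _root_.endFilt W (-1) ≤
      ⨆ j ∈ {j : ℤ | j ≠ 0}, intEig (_root_.adE Y') j := by
    rw [hgr.2]
    exact biSup_mono fun j (hj : j ≤ -1) => show j ≠ 0 by omega
  refine ⟨fun ⟨hf, hNf⟩ => ⟨hf, ?_⟩, fun ⟨hf, hNf⟩ => ⟨hf, hle hNf⟩⟩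
  obtain ⟨P, hP⟩ := exists_isEigenProj hgr.1
  have hker : (⨆ j ∈ {j : ℤ | j ≠ 0}, intEig (_root_.adE Y') j) ≤ LinearMap.ker (P 0) :=
    iSup₂_le fun j hj X hX => hP.apply_ne j 0 hj X hX
  obtain ⟨f', hf', hNf'⟩ := h.exists_zeroComponent hW hN
  have h1 : P 0 (f' - f) = 0 := by
    have := sub_mem (hker hNf) (hker (hle hNf'))
    rwa [sub_sub_sub_cancel_left] at this
  rw [hP.apply_self 0 _ (mem_intEig.2 (by simp [hf, hf']))] at h1
  rwa [← sub_eq_zero.1 h1]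

end ZeroComponent

section DeligneGradingProperty

variable {K V : Type} [Field K] [CharZero K] [AddCommGroup V] [Module K V]
  [FiniteDimensional K V] {W : ℤ → Submodule K V} {Y Y' N : Module.End K V}

theorem isDGP_iff_exists_isRelTriple (hW : IsIncFilt W) (hN : N ∈ endFilt W 0) :
    (IsGrading Y' W ∧ Y * Y' = Y' * Y ∧ HasDGP N Y Y') ↔
      ∃ e f, IsRelTriple W Y Y' e f ∧ N - f ∈ endFilt W (-1) ∧ adE e (N - f) = 0 := by
  constructor
  · rintro ⟨hg, hc, f, e, hf, he, ⟨h1, h2, h3⟩, h4⟩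
    have hact := hg.actsByWeight
    obtain ⟨hf1, hf2⟩ := (hact.isZeroComponent_iff hW hN).1 hf
    refine ⟨e, f, ⟨hact, adE_eq_zero.2 hc, ?_, ?_, he, hf1, h2⟩, hf2, adE_eq_zero.2 h4.symm⟩
    · have : adE (Y - Y') e = (2 : K) • e := h1.trans (by module)
      rwa [adE_sub_left, he, sub_zero] at this
    · have : adE (Y - Y') f = (-2 : K) • f := h3.trans (by module)
      rwa [adE_sub_left, hf1, sub_zero] at this
  · rintro ⟨e, f, ht, hNf, hc⟩
    refine ⟨ht.acts.isGrading hW, adE_eq_zero.1 ht.comm, f, e,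
      (ht.acts.isZeroComponent_iff hW hN).2 ⟨ht.lower_comm, hNf⟩, ht.raise_comm, ⟨?_, ht.bracket, ?_⟩,
      (adE_eq_zero.1 hc).symm⟩
    · change adE (Y - Y') e = _
      rw [adE_sub_left, ht.raise, ht.raise_comm, sub_zero]
      module
    · change adE (Y - Y') f = _
      rw [adE_sub_left, ht.lower, ht.lower_comm, sub_zero]
      module

end DeligneGradingProperty

/-- Deligne: Let `(W, N, Y)` be a one-variable Deligne system on a
finite-dimensional vector space over a field of characteristic zero.  Then there exists a
unique grading `Y'` of `W` with `[Y, Y'] = 0` which has the Deligne grading property: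
there exists `N₀⁺` with `[Y', N₀⁺] = 0` such that `(N₀⁺, Y - Y', N₀)` is a standard triple
and `[N - N₀, N₀⁺] = 0`, where `N₀` is the component of `N` in the `0`-eigenspace of
`ad Y'`. -/
theorem stmt9 {K V : Type} [Field K] [CharZero K] [AddCommGroup V] [Module K V]
    [FiniteDimensional K V]
    (W : ℤ → Submodule K V) (N Y : Module.End K V)
    (hDS : IsDeligneSystem1 W N Y) :
    ∃! Y' : Module.End K V, IsGrading Y' W ∧ Y * Y' = Y' * Y ∧ HasDGP N Y Y' := by
  obtain ⟨hW, -, hNW, M, hMF, hYM, hYW, hYN, hrel⟩ := hDS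
  have hN : N ∈ endFilt W 0 := fun i w hw => by
    rw [add_zero]
    exact hNW i (Submodule.mem_map_of_mem hw)
  have hY : Y ∈ endFilt W 0 := fun i w hw => by
    rw [add_zero]
    exact hYW i (Submodule.mem_map_of_mem hw)
  have hYN' : adE Y N = (-2 : K) • N := hYN.trans (by module)
  have hadY := (hYM.actsByWeight.adE.isGrading hMF.endFilt).1
  obtain ⟨D, hD, hYD⟩ := exists_actsByWeight_commute hW hadY hY
  obtain ⟨f, hf, hNf⟩ := hD.exists_zeroComponent hW hN
  have hYf := hD.adE_zeroComponent hW hY (adE_eq_zero.2 hYD) hYN' hf hNf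
  obtain ⟨e, hYe, hDe, hef⟩ := hrel.exists_raising hYM hadY (hD.adE.isGrading hW.endFilt).1 hY
    (hD.isGrading hW) hYD (by exact_mod_cast hYf) (adE_eq_zero.1 hf) hN
    (hD.mem_endFilt_of_adE_eq_zero hW hf) hNf
  have ht : IsRelTriple W Y D e f := ⟨hD, adE_eq_zero.2 hYD, hYe, hYf, hDe, hf, hef⟩
  simp only [isDGP_iff_exists_isRelTriple hW hN]
  obtain ⟨Y', e', f', h1, h2, h3⟩ := ht.exists_commute hW hYN' hNf
  refine ⟨Y', ⟨e', f', h1, h2, h3⟩, fun Y₂ h₂ => ?_⟩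
  obtain ⟨e₂, f₂, k1, k2, k3⟩ := h₂
  exact k1.grading_unique h1 hW k2 k3 h3
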